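/- Let M = (ℚ, <, ℤ) with ℤ as a unary predicate, and let N be the structure with universe {0,1} × ℚ equipped with the lexicographic order, in which the unary predicate is interpreted as {0,1} × ℤ. Then N is elementarily equivalent to M, but N is not almost o-minimal: the set of predicate points lying between (0,0) and (1,0) is a bounded definable subset of N that is not a finite union of points and open intervals. -/

import Mathlib

open FirstOrder FirstOrder.Language

universe u v w x

/-- A subset of a linear order is an open interval (possibly unbounded). -/
def IsOpenIntervalSet {M : Type w} [LinearOrder M] (s : Set M) : Prop :=
  (∃ a b : M, s = Set.Ioo a b) ∨ (∃ a : M, s = Set.Ioi a) ∨ (∃ b : M, s = Set.Iio b) ∨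
    s = Set.univ

/-- `s` is a finite union of points and open intervals. -/
def IsFinUnionPointsIntervals {M : Type w} [LinearOrder M] (s : Set M) : Prop :=
  ∃ (F : Finset M) (n : ℕ) (J : Fin n → Set M),
    (∀ k, IsOpenIntervalSet (J k)) ∧ s = ↑F ∪ ⋃ k, J k

/-- `M` is o-minimal: every subset of `M` definable with parameters is a finite union of
points and open intervals. -/
def IsOMinimal (L : FirstOrder.Language.{u, v}) (M : Type w) [L.Structure M]
    [LinearOrder M] : Prop :=
  ∀ s : Set M, (Set.univ : Set M).Definable₁ L s → IsFinUnionPointsIntervals s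

/-- `M` is almost o-minimal: every bounded definable (with parameters) subset of `M` is a
finite union of points and open intervals. -/
def IsAlmostOMinimal (L : FirstOrder.Language.{u, v}) (M : Type w) [L.Structure M]
    [LinearOrder M] : Prop :=
  ∀ s : Set M, (Set.univ : Set M).Definable₁ L s → BddAbove s → BddBelow s →
    IsFinUnionPointsIntervals s

/-- `M` is downward o-minimal: every definable (with parameters) subset of `M` that is
bounded above is a finite union of points and open intervals. -/
def IsDownwardOMinimal (L : FirstOrder.Language.{u, v}) (M : Type w) [L.Structure M]
    [LinearOrder M] : Prop :=
  ∀ s : Set M, (Set.univ : Set M).Definable₁ L s → BddAbove s → IsFinUnionPointsIntervals s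

/-- `M` is upward o-minimal: every definable (with parameters) subset of `M` that is
bounded below is a finite union of points and open intervals. -/
def IsUpwardOMinimal (L : FirstOrder.Language.{u, v}) (M : Type w) [L.Structure M]
    [LinearOrder M] : Prop :=
  ∀ s : Set M, (Set.univ : Set M).Definable₁ L s → BddBelow s → IsFinUnionPointsIntervals s

/-- The relation symbols of the language `{<, Z}`: a unary predicate `z` and a binary
relation `lt`. -/
inductive QZRel : ℕ → Type
  | z : QZRel 1
  | lt : QZRel 2

/-- The language with a binary relation symbol `<` and a unary predicate symbol `Z`
(and no function symbols). -/
def QZLang : FirstOrder.Language where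
  Functions _ := Empty
  Relations := QZRel

/-- The structure `M = (ℚ, <, ℤ)`: the universe is `ℚ`, `lt` is the usual order and `z`
is interpreted as the set of integers. -/
instance : QZLang.Structure ℚ where
  funMap := fun f _ => f.elim
  RelMap := fun r x =>
    match r with
    | QZRel.z => ∃ m : ℤ, (m : ℚ) = x 0
    | QZRel.lt => x 0 < x 1

/-- The structure `N`: the universe is `{0,1} × ℚ` with the lexicographic order (realized
as `Fin 2 ×ₗ ℚ`), `lt` is the lexicographic order and `z` is interpreted as
`{0,1} × ℤ`. -/
instance : QZLang.Structure (Fin 2 ×ₗ ℚ) where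
  funMap := fun f _ => f.elim
  RelMap := fun r x =>
    match r with
    | QZRel.z => ∃ m : ℤ, (ofLex (x 0)).2 = (m : ℚ)
    | QZRel.lt => x 0 < x 1

/-- The set of predicate points of `N` lying strictly between `(0,0)` and `(1,0)`. -/
def lexPredicatePointsBetween : Set (Fin 2 ×ₗ ℚ) :=
  {p | (∃ m : ℤ, (ofLex p).2 = (m : ℚ)) ∧ toLex (0, 0) < p ∧ p < toLex (1, 0)}

/-- `ShiftLE p n q` says that the translate `(p.1, p.2 + n)` is lexicographically at most `q`. -/
def ShiftLE (p : ℤ × ℤ) (n : ℤ) (q : ℤ × ℤ) : Prop :=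
  p.1 < q.1 ∨ p.1 = q.1 ∧ p.2 + n ≤ q.2

/-- Two families of points of `ℤ ×ₗ ℤ` have the same order and the same mutual distances, as far
as these can be seen with translations by at most `b`. -/
def SameUpTo {ι : Type*} (b : ℕ) (p q : ι → ℤ × ℤ) : Prop :=
  ∀ i j, ∀ n : ℤ, |n| ≤ b → (ShiftLE (p i) n (p j) ↔ ShiftLE (q i) n (q j))

theorem SameUpTo.mono {ι : Type*} {b c : ℕ} (hbc : b ≤ c) {p q : ι → ℤ × ℤ}
    (h : SameUpTo c p q) : SameUpTo b p q :=
  fun i j n hn => h i j n (hn.trans (by exact_mod_cast hbc))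

theorem SameUpTo.symm {ι : Type*} {b : ℕ} {p q : ι → ℤ × ℤ}
    (h : SameUpTo b p q) : SameUpTo b q p :=
  fun i j n hn => (h i j n hn).symm

/-- A nonempty finite set of indices has one whose point is largest. -/
theorem exists_shiftLE_max {ι : Type*} (p : ι → ℤ × ℤ) {s : Finset ι} (hs : s.Nonempty) :
    ∃ a ∈ s, ∀ i ∈ s, ShiftLE (p i) 0 (p a) := by
  obtain ⟨a, ha, h⟩ := s.exists_max_image (fun i => toLex (p i)) hs
  exact ⟨a, ha, fun i hi => by simpa [ShiftLE, Prod.Lex.le_iff] using h i hi⟩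

/-- A nonempty finite set of indices has one whose point is smallest. -/
theorem exists_shiftLE_min {ι : Type*} (p : ι → ℤ × ℤ) {s : Finset ι} (hs : s.Nonempty) :
    ∃ a ∈ s, ∀ i ∈ s, ShiftLE (p a) 0 (p i) := by
  obtain ⟨a, ha, h⟩ := s.exists_min_image (fun i => toLex (p i)) hs
  exact ⟨a, ha, fun i hi => by simpa [ShiftLE, Prod.Lex.le_iff] using h i hi⟩

/-- The extension step of the back-and-forth argument: a new point `x` on one side is answered by
a point `y` lying in a copy of `ℤ` that is already in use (if there is one). -/
theorem SameUpTo.exists_extension {ι : Type*} [Finite ι] {b : ℕ} {p q : ι → ℤ × ℤ}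
    (h : SameUpTo (4 * b + 4) p q) (x : ℤ × ℤ) (d : ℤ) :
    ∃ y : ℤ × ℤ, (y.1 = d ∨ ∃ i, y.1 = (q i).1) ∧
      ∀ i, ∀ n : ℤ, |n| ≤ b →
        (ShiftLE (p i) n x ↔ ShiftLE (q i) n y) ∧ (ShiftLE x n (p i) ↔ ShiftLE y n (q i)) := by
  classical
  have := Fintype.ofFinite ι
  by_cases hnear : ∃ i, ∃ n : ℤ, |n| ≤ b ∧ x.1 = (p i).1 ∧ x.2 = (p i).2 + n
  · obtain ⟨a, m, hm, h1, h2⟩ := hnear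
    refine ⟨((q a).1, (q a).2 + m), Or.inr ⟨a, rfl⟩, fun i n hn => ⟨?_, ?_⟩⟩
    · have := h i a (n - m) (by rw [abs_le] at *; push_cast; omega)
      unfold ShiftLE at *; simp only; omega
    · have := h a i (m + n) (by rw [abs_le] at *; push_cast; omega)
      unfold ShiftLE at *; simp only; omega
  have hfar : ∀ i, ShiftLE (p i) (b + 1) x ∨ ShiftLE x (b + 1) (p i) := by
    intro i
    by_contra hc
    refine hnear ⟨i, x.2 - (p i).2, ?_⟩
    rw [abs_le]; unfold ShiftLE at hc; omega
  -- it suffices to place `y` on the same side of every point, at distance more than `b`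
  suffices hy : ∃ y : ℤ × ℤ, (y.1 = d ∨ ∃ i, y.1 = (q i).1) ∧
      ∀ i, (ShiftLE (p i) (b + 1) x → ShiftLE (q i) (b + 1) y) ∧
        (ShiftLE x (b + 1) (p i) → ShiftLE y (b + 1) (q i)) by
    obtain ⟨y, hy1, hy⟩ := hy
    refine ⟨y, hy1, fun i n hn => ?_⟩
    have h1 := hfar i
    have h2 := hy i
    rw [abs_le] at hn
    unfold ShiftLE at *; omega
  by_cases hL : (Finset.univ.filter fun i => ShiftLE (p i) (b + 1) x).Nonempty
  · obtain ⟨a, ha, hmax⟩ := exists_shiftLE_max p hL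
    simp only [Finset.mem_filter, Finset.mem_univ, true_and] at ha hmax
    refine ⟨((q a).1, (q a).2 + b + 1), Or.inr ⟨a, rfl⟩, fun i => ⟨fun hi => ?_, fun hi => ?_⟩⟩
    · have h1 := (h i a 0 (by simp; omega)).1 (hmax i hi)
      unfold ShiftLE at *; simp only; omega
    · have h1 := (h a i (2 * b + 2) (by rw [abs_le]; push_cast; omega)).1
        (by unfold ShiftLE at *; omega)
      unfold ShiftLE at *; simp only; omega
  have hL' : ∀ i, ¬ ShiftLE (p i) (b + 1) x := fun i hi => hL ⟨i, by simpa using hi⟩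
  by_cases hU : (Finset.univ : Finset ι).Nonempty
  · obtain ⟨a, -, hmin⟩ := exists_shiftLE_min p hU
    refine ⟨((q a).1, (q a).2 - b - 1), Or.inr ⟨a, rfl⟩, fun i => ⟨fun hi => (hL' i hi).elim,
      fun hi => ?_⟩⟩
    have h1 := (h a i 0 (by simp; omega)).1 (hmin i (Finset.mem_univ i))
    unfold ShiftLE at *; simp only; omega
  · exact ⟨(d, 0), Or.inl rfl, fun i => (hU ⟨i, Finset.mem_univ i⟩).elim⟩

/-- Appending to both families points in matching position preserves `SameUpTo`. -/
theorem SameUpTo.snoc {m b : ℕ} {p q : Fin m → ℤ × ℤ} (h : SameUpTo b p q) {x y : ℤ × ℤ}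
    (hxy : ∀ i, ∀ n : ℤ, |n| ≤ b →
      (ShiftLE (p i) n x ↔ ShiftLE (q i) n y) ∧ (ShiftLE x n (p i) ↔ ShiftLE y n (q i))) :
    SameUpTo b (Fin.snoc p x : Fin (m + 1) → ℤ × ℤ) (Fin.snoc q y) := by
  intro i j n hn
  induction i using Fin.lastCases with
  | last =>
    induction j using Fin.lastCases with
    | last => simp [ShiftLE]
    | cast j => simpa using (hxy j n hn).2
  | cast i =>
    induction j using Fin.lastCases with
    | last => simpa using (hxy i n hn).1
    | cast j => simpa using h i j n hn

/-- A coding of a `QZLang`-structure by triples: the copy of `ℚ` a point lies in, its floor and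
its fractional part. -/
structure IsBlockCoding (M : Type*) [QZLang.Structure M] (blk : M → ℤ × ℤ) (fr : M → ℚ) :
    Prop where
  eq_iff : ∀ x y, x = y ↔ blk x = blk y ∧ fr x = fr y
  z_iff : ∀ v : Fin 1 → M, Structure.RelMap (L := QZLang) QZRel.z v ↔ fr (v 0) = 0
  lt_iff : ∀ v : Fin 2 → M, Structure.RelMap (L := QZLang) QZRel.lt v ↔
    ShiftLE (blk (v 0)) 0 (blk (v 1)) ∧ (blk (v 0) = blk (v 1) → fr (v 0) < fr (v 1))
  fr_mem : ∀ x, fr x ∈ Set.Ico (0 : ℚ) 1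
  exists_point : ∀ x : M, ∀ k : ℤ, ∀ f ∈ Set.Ico (0 : ℚ) 1,
    ∃ y, blk y = ((blk x).1, k) ∧ fr y = f

theorem SameUpTo.eq_iff {ι : Type*} {b : ℕ} {p q : ι → ℤ × ℤ} (h : SameUpTo b p q) (i j : ι) :
    p i = p j ↔ q i = q j := by
  have h1 := h i j 0 (by simp)
  have h2 := h j i 0 (by simp)
  unfold ShiftLE at h1 h2
  rw [Prod.ext_iff, Prod.ext_iff]
  omega

namespace IsBlockCoding

variable {M N : Type*} [QZLang.Structure M] [QZLang.Structure N]
  {blkM : M → ℤ × ℤ} {frM : M → ℚ} {blkN : N → ℤ × ℤ} {frN : N → ℚ}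

/-- One round of the back-and-forth game between two coded structures. -/
theorem exists_answer [Nonempty N] (hM : IsBlockCoding M blkM frM) (hN : IsBlockCoding N blkN frN)
    {n b : ℕ} {xs : Fin n → M} {ys : Fin n → N}
    (hfr : ∀ i, frM (xs i) = frN (ys i))
    (h : SameUpTo (4 * b + 4) (blkM ∘ xs) (blkN ∘ ys)) (x : M) :
    ∃ y : N, (∀ i, frM ((Fin.snoc xs x : Fin (n + 1) → M) i) =
        frN ((Fin.snoc ys y : Fin (n + 1) → N) i)) ∧
      SameUpTo b (blkM ∘ (Fin.snoc xs x : Fin (n + 1) → M))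
        (blkN ∘ (Fin.snoc ys y : Fin (n + 1) → N)) := by
  obtain ⟨w⟩ := ‹Nonempty N›
  obtain ⟨c, hc, hext⟩ := h.exists_extension (blkM x) (blkN w).1
  obtain ⟨y₀, hy₀⟩ : ∃ y₀ : N, (blkN y₀).1 = c.1 := by
    rcases hc with hc | ⟨i, hc⟩
    exacts [⟨w, hc.symm⟩, ⟨ys i, hc.symm⟩]
  obtain ⟨y, hy, hyf⟩ := hN.exists_point y₀ c.2 (frM x) (hM.fr_mem x)
  have hyc : blkN y = c := by rw [hy, hy₀]
  refine ⟨y, fun i => ?_, ?_⟩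
  · induction i using Fin.lastCases with
    | last => simp [hyf]
    | cast i => simpa using hfr i
  · rw [Fin.comp_snoc, Fin.comp_snoc, hyc]
    exact (h.mono (by omega)).snoc hext

/-- A formula cannot distinguish tuples with equal fractional parts whose floors agree up to
a sufficiently large bound. -/
theorem exists_bound_realize_iff [Nonempty M] [Nonempty N]
    (hM : IsBlockCoding M blkM frM) (hN : IsBlockCoding N blkN frN)
    {n : ℕ} (φ : QZLang.BoundedFormula Empty n) :
    ∃ b : ℕ, ∀ (xs : Fin n → M) (ys : Fin n → N), (∀ i, frM (xs i) = frN (ys i)) →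
      SameUpTo b (blkM ∘ xs) (blkN ∘ ys) → (φ.Realize default xs ↔ φ.Realize default ys) := by
  have hterm : ∀ {n : ℕ} (t : QZLang.Term (Empty ⊕ Fin n)), ∃ i, t = Term.var (Sum.inr i) := by
    rintro n (⟨e | i⟩ | ⟨f, _⟩)
    exacts [e.elim, ⟨i, rfl⟩, f.elim]
  induction φ with
  | falsum => exact ⟨0, fun _ _ _ _ => Iff.rfl⟩
  | equal t₁ t₂ =>
    obtain ⟨i, rfl⟩ := hterm t₁
    obtain ⟨j, rfl⟩ := hterm t₂
    refine ⟨0, fun xs ys hfr h => ?_⟩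
    have := h.eq_iff i j
    simp only [Function.comp_apply] at this
    simp only [BoundedFormula.Realize, Term.realize_var, Sum.elim_inr]
    rw [hM.eq_iff, hN.eq_iff, hfr, hfr, this]
  | rel R ts =>
    choose i hi using fun k => hterm (ts k)
    obtain rfl : ts = fun k => Term.var (Sum.inr (i k)) := funext hi
    refine ⟨0, fun xs ys hfr h => ?_⟩
    simp only [BoundedFormula.Realize, Term.realize_var, Sum.elim_inr]
    cases R with
    | z =>
      rw [hM.z_iff, hN.z_iff, hfr]
    | lt =>
      have h1 := h.eq_iff (i 0) (i 1)
      have h2 := h (i 0) (i 1) 0 (by simp)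
      simp only [Function.comp_apply] at h1 h2
      rw [hM.lt_iff, hN.lt_iff, hfr, hfr, h1, h2]
  | imp φ ψ ihφ ihψ =>
    obtain ⟨b, hb⟩ := ihφ
    obtain ⟨c, hc⟩ := ihψ
    refine ⟨max b c, fun xs ys hfr h => ?_⟩
    rw [BoundedFormula.realize_imp, BoundedFormula.realize_imp,
      hb xs ys hfr (h.mono (le_max_left _ _)), hc xs ys hfr (h.mono (le_max_right _ _))]
  | all φ ih =>
    obtain ⟨b, hb⟩ := ih
    refine ⟨4 * b + 4, fun xs ys hfr h => ?_⟩
    rw [BoundedFormula.realize_all, BoundedFormula.realize_all]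
    constructor
    · intro hx y
      obtain ⟨x, hf, hs⟩ := hN.exists_answer hM (fun i => (hfr i).symm) h.symm y
      exact (hb _ _ (fun i => (hf i).symm) hs.symm).1 (hx x)
    · intro hy x
      obtain ⟨y, hf, hs⟩ := hM.exists_answer hN hfr h x
      exact (hb _ _ hf hs).2 (hy y)

theorem elementarilyEquivalent [Nonempty M] [Nonempty N]
    (hM : IsBlockCoding M blkM frM) (hN : IsBlockCoding N blkN frN) : M ≅[QZLang] N := by
  rw [elementarilyEquivalent_iff]
  intro φ
  obtain ⟨b, hb⟩ := hM.exists_bound_realize_iff hN φ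
  exact hb default default (fun i => i.elim0) (fun i => i.elim0)

end IsBlockCoding

theorem lt_iff_floor_le_and_fract_lt (x y : ℚ) :
    x < y ↔ ⌊x⌋ ≤ ⌊y⌋ ∧ (⌊x⌋ = ⌊y⌋ → Int.fract x < Int.fract y) := by
  have hx := Int.floor_add_fract x
  have hy := Int.floor_add_fract y
  constructor
  · intro h
    refine ⟨Int.floor_mono h.le, fun he => ?_⟩
    rw [he] at hx
    linarith
  · rintro ⟨h1, h2⟩
    rcases h1.lt_or_eq with h | h
    · exact (Int.lt_floor_add_one x).trans_le ((by exact_mod_cast h : (⌊x⌋ : ℚ) + 1 ≤ ⌊y⌋).trans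
        (Int.floor_le y))
    · have := h2 h
      rw [h] at hx
      linarith

theorem eq_iff_floor_eq_and_fract_eq (x y : ℚ) :
    x = y ↔ ⌊x⌋ = ⌊y⌋ ∧ Int.fract x = Int.fract y := by
  refine ⟨fun h => by simp [h], fun ⟨h1, h2⟩ => ?_⟩
  rw [← Int.floor_add_fract x, h1, h2, Int.floor_add_fract]

theorem isBlockCoding_rat :
    IsBlockCoding ℚ (fun x => (0, ⌊x⌋)) (fun x => Int.fract x) where
  eq_iff x y := by simpa using eq_iff_floor_eq_and_fract_eq x y
  z_iff v := Int.fract_eq_zero_iff.symm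
  lt_iff v := by
    change v 0 < v 1 ↔ _
    simpa [ShiftLE] using lt_iff_floor_le_and_fract_lt (v 0) (v 1)
  fr_mem x := ⟨Int.fract_nonneg x, Int.fract_lt_one x⟩
  exists_point x k f hf := by
    have : ⌊f⌋ = 0 := Int.floor_eq_zero_iff.2 hf
    exact ⟨k + f, by simp [this], by simpa using Int.fract_eq_self.2 hf⟩

theorem isBlockCoding_lex :
    IsBlockCoding (Fin 2 ×ₗ ℚ) (fun x => (((ofLex x).1 : ℕ), ⌊(ofLex x).2⌋))
      (fun x => Int.fract (ofLex x).2) where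
  eq_iff x y := by
    rw [← ofLex_inj, Prod.ext_iff, eq_iff_floor_eq_and_fract_eq]
    simp [Fin.ext_iff, and_assoc]
  z_iff v := by
    rw [Int.fract_eq_zero_iff]
    exact exists_congr fun m => eq_comm
  lt_iff v := by
    change v 0 < v 1 ↔ _
    rw [Prod.Lex.lt_iff, lt_iff_floor_le_and_fract_lt]
    simp only [ShiftLE, Prod.mk.injEq, Fin.lt_def, Fin.ext_iff, Nat.cast_lt, Nat.cast_inj, add_zero]
    grind
  fr_mem x := ⟨Int.fract_nonneg _, Int.fract_lt_one _⟩
  exists_point x k f hf := by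
    have : ⌊f⌋ = 0 := Int.floor_eq_zero_iff.2 hf
    exact ⟨toLex ((ofLex x).1, k + f), by simp [this], by simpa using Int.fract_eq_self.2 hf⟩

theorem definable_lexPredicatePointsBetween :
    (Set.univ : Set (Fin 2 ×ₗ ℚ)).Definable₁ QZLang lexPredicatePointsBetween := by
  let x : QZLang[[(Set.univ : Set (Fin 2 ×ₗ ℚ))]].Term (Fin 1) := Term.var 0
  let c (p : Fin 2 ×ₗ ℚ) : QZLang[[(Set.univ : Set (Fin 2 ×ₗ ℚ))]].Term (Fin 1) :=
    (QZLang.con (⟨p, trivial⟩ : (Set.univ : Set (Fin 2 ×ₗ ℚ)))).term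
  let z : QZLang[[(Set.univ : Set (Fin 2 ×ₗ ℚ))]].Relations 1 := Sum.inl QZRel.z
  let lt : QZLang[[(Set.univ : Set (Fin 2 ×ₗ ℚ))]].Relations 2 := Sum.inl QZRel.lt
  refine ⟨z.formula₁ x ⊓ (lt.formula₂ (c (toLex (0, 0))) x ⊓ lt.formula₂ x (c (toLex (1, 0)))), ?_⟩
  ext v
  rw [Set.mem_ofPred_eq, Set.mem_ofPred_eq, Formula.realize_inf, Formula.realize_inf,
    Formula.realize_rel₁, Formula.realize_rel₂, Formula.realize_rel₂]
  simp only [c, Term.realize_con]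
  exact Iff.rfl

theorem exists_Ico_subset_of_isOpenIntervalSet {M : Type*} [LinearOrder M] [NoMaxOrder M]
    {s : Set M} (hs : IsOpenIntervalSet s) {p : M} (hp : p ∈ s) :
    ∃ b, p < b ∧ Set.Ico p b ⊆ s := by
  obtain ⟨d, hd⟩ := exists_gt p
  rcases hs with ⟨a, b, rfl⟩ | ⟨a, rfl⟩ | ⟨b, rfl⟩ | rfl
  · exact ⟨b, hp.2, fun x hx => ⟨hp.1.trans_le hx.1, hx.2⟩⟩
  · exact ⟨d, hd, fun x hx => lt_of_lt_of_le hp hx.1⟩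
  · exact ⟨b, hp, fun x hx => hx.2⟩
  · exact ⟨d, hd, Set.subset_univ _⟩

/-- Just above a predicate point there are points outside the predicate. -/
theorem exists_mem_Ico_not_int {p b : Fin 2 ×ₗ ℚ} (hp : ∃ m : ℤ, (ofLex p).2 = m) (hb : p < b) :
    ∃ q ∈ Set.Ico p b, ¬ ∃ m : ℤ, (ofLex q).2 = m := by
  obtain ⟨m, hm⟩ := hp
  obtain ⟨e, he0, he1, heb⟩ : ∃ e : ℚ, 0 < e ∧ e < 1 ∧
      toLex ((ofLex p).1, (ofLex p).2 + e) < b := by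
    rw [Prod.Lex.lt_iff] at hb
    rcases hb with hb | ⟨h1, h2⟩
    · exact ⟨1 / 2, by norm_num, by norm_num, Prod.Lex.lt_iff.2 (Or.inl hb)⟩
    · obtain ⟨e, he0, he⟩ := exists_between (lt_min one_pos (sub_pos.2 h2))
      rw [lt_min_iff] at he
      exact ⟨e, he0, he.1, Prod.Lex.lt_iff.2 (Or.inr ⟨h1, by simp; linarith⟩)⟩
  refine ⟨toLex ((ofLex p).1, (ofLex p).2 + e), ⟨Prod.Lex.le_iff.2 (Or.inr ⟨rfl, by simpa using he0.le⟩), heb⟩, ?_⟩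
  rintro ⟨k, hk⟩
  simp only [ofLex_toLex, hm] at hk
  have h1 : (m : ℚ) < k := by linarith
  have h2 : (k : ℚ) < (m + 1 : ℤ) := by push_cast; linarith
  norm_cast at h1 h2
  omega

theorem infinite_lexPredicatePointsBetween : lexPredicatePointsBetween.Infinite := by
  refine Set.infinite_of_injective_forall_mem
    (f := fun n : ℕ => (toLex (0, (n : ℚ) + 1) : Fin 2 ×ₗ ℚ)) ?_ fun n => ?_
  · intro a b h
    simpa using h
  · refine ⟨⟨n + 1, by simp⟩, Prod.Lex.lt_iff.2 (Or.inr ⟨rfl, ?_⟩),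
      Prod.Lex.lt_iff.2 (Or.inl (by simp))⟩
    simp only [ofLex_toLex]
    positivity

theorem not_isFinUnionPointsIntervals_lexPredicatePointsBetween :
    ¬ IsFinUnionPointsIntervals lexPredicatePointsBetween := by
  rintro ⟨F, n, J, hJ, hs⟩
  have : NoMaxOrder (Fin 2 ×ₗ ℚ) := ⟨fun a =>
    ⟨toLex ((ofLex a).1, (ofLex a).2 + 1), Prod.Lex.lt_iff.2 (Or.inr ⟨rfl, by simp⟩)⟩⟩
  refine infinite_lexPredicatePointsBetween (F.finite_toSet.subset fun p hp => ?_)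
  have hp' := hp
  rw [hs] at hp'
  rcases hp' with hF | hU
  · exact hF
  obtain ⟨k, hk⟩ := Set.mem_iUnion.1 hU
  obtain ⟨b, hb, hsub⟩ := exists_Ico_subset_of_isOpenIntervalSet (hJ k) hk
  obtain ⟨q, hq, hqz⟩ := exists_mem_Ico_not_int hp.1 hb
  have hqs : q ∈ lexPredicatePointsBetween :=
    hs ▸ Set.mem_union_right _ (Set.mem_iUnion_of_mem k (hsub hq))
  exact (hqz hqs.1).elim

/-- With `M = (ℚ, <, ℤ)` and `N = ({0,1} × ℚ, <_lex, {0,1} × ℤ)`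
(realized on `Fin 2 ×ₗ ℚ`), the structure `N` is elementarily equivalent to `M`, but `N`
is not almost o-minimal: the set of predicate points lying between `(0,0)` and `(1,0)` is
a bounded definable subset of `N` that is not a finite union of points and open
intervals. -/
theorem lex_double_rationals_elementarily_equivalent_not_almost_ominimal :
    (ℚ ≅[QZLang] (Fin 2 ×ₗ ℚ)) ∧
    (Set.univ : Set (Fin 2 ×ₗ ℚ)).Definable₁ QZLang lexPredicatePointsBetween ∧
    BddAbove lexPredicatePointsBetween ∧ BddBelow lexPredicatePointsBetween ∧
    ¬ IsFinUnionPointsIntervals lexPredicatePointsBetween ∧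
    ¬ IsAlmostOMinimal QZLang (Fin 2 ×ₗ ℚ) := by
  have hA : BddAbove lexPredicatePointsBetween := ⟨toLex (1, 0), fun _ hp => hp.2.2.le⟩
  have hB : BddBelow lexPredicatePointsBetween := ⟨toLex (0, 0), fun _ hp => hp.2.1.le⟩
  exact ⟨isBlockCoding_rat.elementarilyEquivalent isBlockCoding_lex,
    definable_lexPredicatePointsBetween, hA, hB,
    not_isFinUnionPointsIntervals_lexPredicatePointsBetween,
    fun h => not_isFinUnionPointsIntervals_lexPredicatePointsBetween
      (h _ definable_lexPredicatePointsBetween hA hB)⟩
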